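/- Let r₁, r₂, m be integers with 0 < r₁ < r₂ < m and r₁ even. If there exist two sets C, D ⊆ ℕ with C ∪ D = ℕ and C ∩ D = (r₁ + mℕ) ∪ (r₂ + mℕ) such that R_C(n) = R_D(n) for all n ∈ ℕ, then there exists a positive integer l such that r₁ = 2^(2l+1) − 2, r₂ = 2^(2l+1) − 1, and m = 2^(2l+2) − 2. -/

import Mathlib

/-- `R S n` is the number of pairs `(s, s')` with `s, s' ∈ S`, `s < s'` and `s + s' = n`. -/
noncomputable def R (S : Set ℕ) (n : ℕ) : ℕ :=
  Set.ncard {p : ℕ × ℕ | p.1 ∈ S ∧ p.2 ∈ S ∧ p.1 < p.2 ∧ p.1 + p.2 = n}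

/-- `AP r m` is the arithmetic progression `r + mℕ = {r + m*k : k ∈ ℕ}`. -/
def AP (r m : ℕ) : Set ℕ := {n | ∃ k : ℕ, n = r + m * k}

open Polynomial

/-- The Thue–Morse sequence with values `±1`. -/
def thueMorse : ℕ → ℤ
  | 0 => 1
  | n + 1 => (if Even (n + 1) then 1 else -1) * thueMorse ((n + 1) / 2)
decreasing_by omega

theorem thueMorse_zero : thueMorse 0 = 1 := by
  rw [thueMorse]

theorem thueMorse_two_mul (k : ℕ) : thueMorse (2 * k) = thueMorse k := by
  rcases k with _ | k
  · rfl
  · rw [show 2 * (k + 1) = (2 * k + 1) + 1 by ring, thueMorse, if_pos (by grind), one_mul]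
    congr 1
    omega

theorem thueMorse_two_mul_add_one (k : ℕ) : thueMorse (2 * k + 1) = -thueMorse k := by
  rw [thueMorse, if_neg (by grind), neg_one_mul]
  congr 2
  omega

theorem thueMorse_eq_one_or (n : ℕ) : thueMorse n = 1 ∨ thueMorse n = -1 := by
  induction n using Nat.strong_induction_on with
  | _ n ih =>
    rcases Nat.even_or_odd' n with ⟨k, rfl | rfl⟩
    · rcases Nat.eq_zero_or_pos k with rfl | hk
      · exact Or.inl thueMorse_zero
      · rw [thueMorse_two_mul]
        exact ih k (by omega)
    · rw [thueMorse_two_mul_add_one]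
      have := ih k (by omega)
      omega

theorem thueMorse_not_three_equal (c : ℕ) (h₁ : thueMorse (c + 1) = thueMorse c)
    (h₂ : thueMorse (c + 2) = thueMorse (c + 1)) : False := by
  rcases Nat.even_or_odd' c with ⟨k, rfl | rfl⟩
  · rw [thueMorse_two_mul_add_one, thueMorse_two_mul] at h₁
    have := thueMorse_eq_one_or k
    omega
  · rw [show 2 * k + 1 + 2 = 2 * (k + 1) + 1 by ring, show 2 * k + 1 + 1 = 2 * (k + 1) by ring,
      thueMorse_two_mul_add_one, thueMorse_two_mul] at h₂
    have := thueMorse_eq_one_or (k + 1)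
    omega

/-- No nonempty prefix of the Thue–Morse sequence is a square. -/
theorem thueMorse_prefix_not_square (A : ℕ) (hA : 0 < A)
    (h : ∀ k < A, thueMorse (A + k) = thueMorse k) : False := by
  induction A using Nat.strong_induction_on with
  | _ A ih =>
    rcases Nat.even_or_odd' A with ⟨c, rfl | rfl⟩
    · refine ih c (by omega) (by omega) fun k hk => ?_
      have := h (2 * k) (by omega)
      rwa [← mul_add, thueMorse_two_mul, thueMorse_two_mul] at this
    · have he : ∀ j ≤ c, thueMorse (c + j) = -thueMorse j := fun j hj => by
        have := h (2 * j) (by omega)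
        rw [show 2 * c + 1 + 2 * j = 2 * (c + j) + 1 by ring, thueMorse_two_mul,
          thueMorse_two_mul_add_one] at this
        omega
      have ho : ∀ j < c, thueMorse (c + j + 1) = -thueMorse j := fun j hj => by
        have := h (2 * j + 1) (by omega)
        rwa [show 2 * c + 1 + (2 * j + 1) = 2 * (c + j + 1) by ring, thueMorse_two_mul,
          thueMorse_two_mul_add_one] at this
      have t0 := thueMorse_zero
      have t1 : thueMorse 1 = -1 := by simpa [t0] using thueMorse_two_mul_add_one 0
      have t2 : thueMorse 2 = -1 := by simpa [t1] using thueMorse_two_mul 1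
      obtain rfl | rfl | hc : c = 0 ∨ c = 1 ∨ 2 ≤ c := by omega
      · have := he 0 le_rfl
        simp [t0] at this
      · have := he 1 le_rfl
        simp [t1, t2] at this
      · exact thueMorse_not_three_equal c
          ((ho 0 (by omega)).trans (he 0 (by omega)).symm)
          ((ho 1 (by omega)).trans (he 1 (by omega)).symm)

theorem eq_two_pow_of_thueMorse_antisquare (B : ℕ) (hB : 0 < B)
    (h : ∀ i, i + 2 ≤ B → thueMorse (B + i) = -thueMorse i) : ∃ j, B = 2 ^ j := by
  induction B using Nat.strong_induction_on with
  | _ B ih =>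
    rcases Nat.even_or_odd' B with ⟨c, rfl | rfl⟩
    · obtain ⟨j, rfl⟩ := ih c (by omega) (by omega) fun i hi => by
        have := h (2 * i) (by omega)
        rwa [← mul_add, thueMorse_two_mul, thueMorse_two_mul] at this
      exact ⟨j + 1, by ring⟩
    · have he : ∀ j < c, thueMorse (c + j) = thueMorse j := fun j hj => by
        have := h (2 * j) (by omega)
        rw [show 2 * c + 1 + 2 * j = 2 * (c + j) + 1 by ring, thueMorse_two_mul,
          thueMorse_two_mul_add_one] at this
        omega
      have ho : ∀ j < c, thueMorse (c + j + 1) = thueMorse j := fun j hj => by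
        have := h (2 * j + 1) (by omega)
        rw [show 2 * c + 1 + (2 * j + 1) = 2 * (c + j + 1) by ring, thueMorse_two_mul,
          thueMorse_two_mul_add_one] at this
        omega
      have t0 := thueMorse_zero
      have t1 : thueMorse 1 = -1 := by simpa [t0] using thueMorse_two_mul_add_one 0
      obtain rfl | rfl | hc : c = 0 ∨ c = 1 ∨ 2 ≤ c := by omega
      · exact ⟨0, rfl⟩
      · have := he 0 one_pos
        simp [t0, t1] at this
      · exact (thueMorse_not_three_equal c
          ((ho 0 (by omega)).trans (he 0 (by omega)).symm)
          ((ho 1 (by omega)).trans (he 1 (by omega)).symm)).elim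

theorem thueMorse_two_pow_sub_one (j : ℕ) : thueMorse (2 ^ j - 1) = (-1) ^ j := by
  induction j with
  | zero => exact thueMorse_zero
  | succ j ih =>
    have := Nat.one_le_two_pow (n := j)
    rw [show 2 ^ (j + 1) - 1 = 2 * (2 ^ j - 1) + 1 by rw [pow_succ]; omega,
      thueMorse_two_mul_add_one, ih, pow_succ]
    ring

theorem exists_eq_four_pow_sub_one_of_thueMorse (A : ℕ) (hA : 0 < A) (h₀ : thueMorse A = 1)
    (h : ∀ i, 2 * i + 1 < A → thueMorse (A + (2 * i + 1)) = -thueMorse i) :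
    ∃ l, 0 < l ∧ A + 1 = 2 ^ (2 * l) := by
  rcases Nat.even_or_odd' A with ⟨B, rfl | rfl⟩
  · refine (thueMorse_prefix_not_square B (by omega) fun k hk => ?_).elim
    have := h k (by omega)
    rw [show 2 * B + (2 * k + 1) = 2 * (B + k) + 1 by ring, thueMorse_two_mul_add_one] at this
    omega
  · obtain ⟨j, hj⟩ := eq_two_pow_of_thueMorse_antisquare (B + 1) (by omega) fun i hi => by
      have := h i (by omega)
      rwa [show 2 * B + 1 + (2 * i + 1) = 2 * (B + 1 + i) by ring, thueMorse_two_mul] at this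
    have e : 2 * B + 1 + 1 = 2 ^ (j + 1) := by rw [pow_succ, ← hj]; ring
    rw [show 2 * B + 1 = 2 ^ (j + 1) - 1 by omega, thueMorse_two_pow_sub_one] at h₀
    obtain ⟨l, hl⟩ := (neg_one_pow_eq_one_iff_even (by norm_num)).1 h₀
    exact ⟨l, by omega, by rw [e, hl]; ring⟩

/-- A sequence which vanishes at odd indices and takes the value `f k` at `2 * k`. -/
def spread {R : Type*} [Zero R] (f : ℕ → R) (n : ℕ) : R := if Even n then f (n / 2) else 0

/-- `(1 - X) (1 - X ^ m)` times the generating function of `ℕ` with the elements of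
`(a + mℕ) ∪ (b + mℕ)` counted twice. -/
noncomputable def numer (R : Type*) [CommRing R] (a b m : ℕ) : R[X] :=
  (1 - X ^ m) + (1 - X) * (X ^ a + X ^ b)

/-- The functional equation, coefficient by coefficient, below `m`. -/
theorem coeff_relation {f : ℕ → ℤ} {a b m : ℕ}
    (hF : PowerSeries.mk f * (numer ℤ a b m : PowerSeries ℤ) =
      PowerSeries.mk (spread f) * (((1 - X) * (1 - X ^ m) : ℤ[X]) : PowerSeries ℤ))
    (n : ℕ) (hn : n < m) :
    f n + ((if a ≤ n then f (n - a) else 0) - (if a + 1 ≤ n then f (n - (a + 1)) else 0)) +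
      ((if b ≤ n then f (n - b) else 0) - (if b + 1 ≤ n then f (n - (b + 1)) else 0)) =
    spread f n - (if 1 ≤ n then spread f (n - 1) else 0) := by
  have h := congrArg (PowerSeries.coeff n) hF
  have e₁ : PowerSeries.mk f * (numer ℤ a b m : PowerSeries ℤ) =
      PowerSeries.mk f - PowerSeries.mk f * PowerSeries.X ^ m +
      PowerSeries.mk f * PowerSeries.X ^ a - PowerSeries.mk f * PowerSeries.X ^ (a + 1) +
      PowerSeries.mk f * PowerSeries.X ^ b - PowerSeries.mk f * PowerSeries.X ^ (b + 1) := by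
    simp only [numer, Polynomial.coe_add, Polynomial.coe_sub, Polynomial.coe_mul,
      Polynomial.coe_one, Polynomial.coe_pow, Polynomial.coe_X]
    ring
  have e₂ : PowerSeries.mk (spread f) * (((1 - X) * (1 - X ^ m) : ℤ[X]) : PowerSeries ℤ) =
      PowerSeries.mk (spread f) - PowerSeries.mk (spread f) * PowerSeries.X ^ 1 -
      PowerSeries.mk (spread f) * PowerSeries.X ^ m +
      PowerSeries.mk (spread f) * PowerSeries.X ^ (m + 1) := by
    simp only [Polynomial.coe_sub, Polynomial.coe_mul,
      Polynomial.coe_one, Polynomial.coe_pow, Polynomial.coe_X]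
    ring
  rw [e₁, e₂] at h
  simp only [map_add, map_sub, PowerSeries.coeff_mul_X_pow', PowerSeries.coeff_mk,
    if_neg (show ¬ m ≤ n by omega), if_neg (show ¬ m + 1 ≤ n by omega)] at h
  linarith

theorem spread_two_mul {R : Type*} [Zero R] (f : ℕ → R) (k : ℕ) : spread f (2 * k) = f k := by
  simp [spread]

theorem spread_two_mul_add_one {R : Type*} [Zero R] (f : ℕ → R) (k : ℕ) :
    spread f (2 * k + 1) = 0 := by
  simp [spread]

section Combinatorial

variable {f : ℕ → ℤ} {a b m : ℕ}

theorem even_relation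
    (hF : PowerSeries.mk f * (numer ℤ a b m : PowerSeries ℤ) =
      PowerSeries.mk (spread f) * (((1 - X) * (1 - X ^ m) : ℤ[X]) : PowerSeries ℤ))
    (k : ℕ) (hn : 2 * k < m) :
    f (2 * k) + ((if a ≤ 2 * k then f (2 * k - a) else 0) -
      (if a + 1 ≤ 2 * k then f (2 * k - (a + 1)) else 0)) +
      ((if b ≤ 2 * k then f (2 * k - b) else 0) -
      (if b + 1 ≤ 2 * k then f (2 * k - (b + 1)) else 0)) = f k := by
  have := coeff_relation hF (2 * k) hn
  rw [this, spread_two_mul]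
  rcases k with _ | k
  · simp
  · rw [show 2 * (k + 1) - 1 = 2 * k + 1 by omega, spread_two_mul_add_one]
    simp

theorem odd_relation
    (hF : PowerSeries.mk f * (numer ℤ a b m : PowerSeries ℤ) =
      PowerSeries.mk (spread f) * (((1 - X) * (1 - X ^ m) : ℤ[X]) : PowerSeries ℤ))
    (k : ℕ) (hn : 2 * k + 1 < m) :
    f (2 * k + 1) + ((if a ≤ 2 * k + 1 then f (2 * k + 1 - a) else 0) -
      (if a + 1 ≤ 2 * k + 1 then f (2 * k + 1 - (a + 1)) else 0)) +
      ((if b ≤ 2 * k + 1 then f (2 * k + 1 - b) else 0) -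
      (if b + 1 ≤ 2 * k + 1 then f (2 * k + 1 - (b + 1)) else 0)) = -f k := by
  have := coeff_relation hF (2 * k + 1) hn
  rw [this, spread_two_mul_add_one, Nat.add_sub_cancel, spread_two_mul]
  simp

theorem eq_thueMorse (h0 : f 0 = 1) (hab : a < b) (hbm : b < m)
    (hF : PowerSeries.mk f * (numer ℤ a b m : PowerSeries ℤ) =
      PowerSeries.mk (spread f) * (((1 - X) * (1 - X ^ m) : ℤ[X]) : PowerSeries ℤ))
    (n : ℕ) (hn : n < a) : f n = thueMorse n := by
  induction n using Nat.strong_induction_on with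
  | _ n ih =>
    rcases Nat.even_or_odd' n with ⟨k, rfl | rfl⟩
    · rcases Nat.eq_zero_or_pos k with rfl | hk
      · rw [h0, thueMorse_zero]
      · have := even_relation hF k (by omega)
        rw [if_neg (by omega), if_neg (by omega), if_neg (by omega), if_neg (by omega),
          ih k (by omega) (by omega)] at this
        rw [thueMorse_two_mul]
        linarith
    · have := odd_relation hF k (by omega)
      rw [if_neg (by omega), if_neg (by omega), if_neg (by omega), if_neg (by omega),
        ih k (by omega) (by omega)] at this
      rw [thueMorse_two_mul_add_one]
      linarith

theorem lt_of_bounded {A : ℕ} (h0 : f 0 = 1) (hf : ∀ n, |f n| ≤ 1) (hA : 0 < A)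
    (hab : 2 * A < b) (hbm : b < m) (hfb : f b = 0)
    (hF : PowerSeries.mk f * (numer ℤ (2 * A) b m : PowerSeries ℤ) =
      PowerSeries.mk (spread f) * (((1 - X) * (1 - X ^ m) : ℤ[X]) : PowerSeries ℤ)) :
    b + 1 < 4 * A := by
  by_contra! hb
  refine thueMorse_prefix_not_square A hA fun k hk => ?_
  have htm := eq_thueMorse h0 hab hbm hF
  have h := odd_relation hF (A + k) (by omega)
  rw [if_pos (by omega), if_pos (by omega), if_neg (show ¬ b + 1 ≤ _ by omega),
    show 2 * (A + k) + 1 - 2 * A = 2 * k + 1 by omega,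
    show 2 * (A + k) + 1 - (2 * A + 1) = 2 * k by omega,
    htm (A + k) (by omega), htm (2 * k + 1) (by omega), htm (2 * k) (by omega), thueMorse_two_mul,
    thueMorse_two_mul_add_one] at h
  have t₁ := thueMorse_eq_one_or k
  have t₂ := thueMorse_eq_one_or (A + k)
  have hn := abs_le.1 (hf (2 * (A + k) + 1))
  by_cases hbk : b ≤ 2 * (A + k) + 1
  · obtain rfl : b = 2 * (A + k) + 1 := by omega
    rw [if_pos le_rfl, Nat.sub_self, h0, hfb] at h
    omega
  · rw [if_neg hbk] at h
    omega

theorem exists_eq_of_consecutive {A : ℕ} (h0 : f 0 = 1) (hf : ∀ n, |f n| ≤ 1) (hA : 0 < A)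
    (hm : m = 2 * A + (2 * A + 1) + 1)
    (hF : PowerSeries.mk f * (numer ℤ (2 * A) (2 * A + 1) m : PowerSeries ℤ) =
      PowerSeries.mk (spread f) * (((1 - X) * (1 - X ^ m) : ℤ[X]) : PowerSeries ℤ)) :
    ∃ l, 0 < l ∧ A + 1 = 2 ^ (2 * l) := by
  have htm := eq_thueMorse h0 (by omega) (by omega) hF
  refine exists_eq_four_pow_sub_one_of_thueMorse A hA ?_ fun i hi => ?_
  · have h := even_relation hF A (by omega)
    rw [if_pos (by omega), if_neg (by omega), if_neg (by omega), Nat.sub_self,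
      h0, htm A (by omega)] at h
    have := thueMorse_eq_one_or A
    have hn := abs_le.1 (hf (2 * A))
    omega
  · have h := even_relation hF (A + (2 * i + 1)) (by omega)
    rw [if_pos (by omega), if_pos (by omega), if_pos (by omega),
      show 2 * (A + (2 * i + 1)) - 2 * A = 2 * (2 * i + 1) by omega,
      show 2 * (A + (2 * i + 1)) - (2 * A + 1 + 1) = 2 * (2 * i) by omega,
      htm (A + (2 * i + 1)) (by omega), htm (2 * (2 * i + 1)) (by omega),
      htm (2 * (2 * i)) (by omega), thueMorse_two_mul, thueMorse_two_mul_add_one,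
      thueMorse_two_mul, thueMorse_two_mul] at h
    have t₁ := thueMorse_eq_one_or i
    have t₂ := thueMorse_eq_one_or (A + (2 * i + 1))
    have hn := abs_le.1 (hf (2 * (A + (2 * i + 1))))
    omega

end Combinatorial

/-- The reciprocal polynomial of `numer`. -/
noncomputable def recipNumer (R : Type*) [CommRing R] (a b m : ℕ) : R[X] :=
  (X ^ m - 1) + (X - 1) * (X ^ (m - 1 - a) + X ^ (m - 1 - b))

theorem numer_eval (a b m : ℕ) (z : ℂ) :
    (numer ℂ a b m).eval z = (1 - z ^ m) + (1 - z) * (z ^ a + z ^ b) := by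
  simp [numer]

theorem recipNumer_eval (a b m : ℕ) (z : ℂ) :
    (recipNumer ℂ a b m).eval z =
      (z ^ m - 1) + (z - 1) * (z ^ (m - 1 - a) + z ^ (m - 1 - b)) := by
  simp [recipNumer]

theorem recipNumer_eval_inv {a b m : ℕ} (ha : a < m) (hb : b < m) {z : ℂ} (hz : z ≠ 0) :
    (recipNumer ℂ a b m).eval z⁻¹ * z ^ m = (numer ℂ a b m).eval z := by
  obtain ⟨c, rfl⟩ : ∃ c, m = c + 1 := ⟨m - 1, by omega⟩
  have e : ∀ k ≤ c, z⁻¹ ^ (c - k) * z ^ c = z ^ k := fun k hk => by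
    rw [inv_pow, inv_mul_eq_div, div_eq_iff (pow_ne_zero _ hz), ← pow_add]
    congr 1
    omega
  have e₁ : z⁻¹ ^ (c + 1) * z ^ (c + 1) = 1 := by
    rw [← mul_pow, inv_mul_cancel₀ hz, one_pow]
  rw [recipNumer_eval, numer_eval, Nat.add_sub_cancel]
  have h₁ := e a (by omega)
  have h₂ := e b (by omega)
  have h₃ : z⁻¹ * z = 1 := inv_mul_cancel₀ hz
  calc _ = z⁻¹ ^ (c + 1) * z ^ (c + 1) - z ^ (c + 1) +
        (z⁻¹ * z - z) * (z⁻¹ ^ (c - a) * z ^ c + z⁻¹ ^ (c - b) * z ^ c) := by ring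
    _ = _ := by rw [h₁, h₂, h₃, e₁]

theorem recipNumer_degree_lt {a b m : ℕ} (ha : 0 < a) (hab : a < b) (hb : b < m) :
    (-1 + (X - 1) * (X ^ (m - 1 - a) + X ^ (m - 1 - b)) : ℂ[X]).degree < (m : ℕ) := by
  have h : (-1 + (X - 1) * (X ^ (m - 1 - a) + X ^ (m - 1 - b)) : ℂ[X]).natDegree ≤ m - a := by
    refine natDegree_add_le_of_degree_le (by simp) ?_
    refine (natDegree_mul_le_of_le (m := 1) (n := m - 1 - a) ?_ ?_).trans (by omega)
    · compute_degree
    · refine natDegree_add_le_of_degree_le (by simp) ?_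
      simp only [natDegree_X_pow]
      omega
  refine degree_le_natDegree.trans_lt ?_
  rw [Nat.cast_lt]
  omega

theorem recipNumer_eq (a b m : ℕ) : recipNumer ℂ a b m =
    X ^ m + (-1 + (X - 1) * (X ^ (m - 1 - a) + X ^ (m - 1 - b))) := by
  rw [recipNumer]
  ring

theorem recipNumer_monic {a b m : ℕ} (ha : 0 < a) (hab : a < b) (hb : b < m) :
    (recipNumer ℂ a b m).Monic := by
  rw [recipNumer_eq]
  exact monic_X_pow_add (recipNumer_degree_lt ha hab hb)

theorem recipNumer_card_roots {a b m : ℕ} (ha : 0 < a) (hab : a < b) (hb : b < m) :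
    (recipNumer ℂ a b m).roots.card = m := by
  rw [← (IsAlgClosed.splits (recipNumer ℂ a b m)).natDegree_eq_card_roots, recipNumer_eq]
  have h := recipNumer_degree_lt ha hab hb
  rw [natDegree_add_eq_left_of_degree_lt (by rwa [degree_X_pow]), natDegree_X_pow]

theorem recipNumer_eval_eq_prod {a b m : ℕ} (ha : 0 < a) (hab : a < b) (hb : b < m) (z : ℂ) :
    (recipNumer ℂ a b m).eval z = ((recipNumer ℂ a b m).roots.map fun β => z - β).prod :=
  (IsAlgClosed.splits _).eval_eq_prod_roots_of_monic (recipNumer_monic ha hab hb) z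

theorem numer_eval_eq_prod {a b m : ℕ} (ha : 0 < a) (hab : a < b) (hb : b < m) (z : ℂ) :
    (numer ℂ a b m).eval z = ((recipNumer ℂ a b m).roots.map fun β => 1 - β * z).prod := by
  by_cases hz : z = 0
  · subst hz
    simp [numer_eval, ha.ne', (ha.trans hab).ne', (ha.trans (hab.trans hb)).ne']
  · rw [← recipNumer_eval_inv (hab.trans hb) hb hz, recipNumer_eval_eq_prod ha hab hb]
    nth_rw 2 [← recipNumer_card_roots ha hab hb]
    rw [← Multiset.prod_replicate, ← Multiset.map_const', ← Multiset.prod_map_mul]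
    congr 1
    refine Multiset.map_congr rfl fun β _ => ?_
    field_simp

theorem numer_eq_prod {a b m : ℕ} (ha : 0 < a) (hab : a < b) (hb : b < m) :
    numer ℂ a b m = ((recipNumer ℂ a b m).roots.map fun β => 1 - C β * X).prod := by
  refine Polynomial.funext fun z => ?_
  rw [numer_eval_eq_prod ha hab hb, eval_multiset_prod, Multiset.map_map]
  simp

theorem norm_root_le_one {a b m : ℕ} (hab : a < b) (hb : b < m)
    (hW : ∀ z : ℂ, ‖z‖ < 1 → (numer ℂ a b m).eval z ≠ 0) {β : ℂ}
    (hβ : β ∈ (recipNumer ℂ a b m).roots) : ‖β‖ ≤ 1 := by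
  by_contra! h
  have hβ0 : β ≠ 0 := fun h0 => by norm_num [h0] at h
  refine hW β⁻¹ (by rw [norm_inv]; exact inv_lt_one_of_one_lt₀ h) ?_
  rw [← recipNumer_eval_inv (hab.trans hb) hb (inv_ne_zero hβ0), inv_inv,
    (isRoot_of_mem_roots hβ : _ = _), zero_mul]

theorem norm_prod_le_one (s : Multiset ℂ) (hs : ∀ β ∈ s, ‖β‖ ≤ 1) : ‖s.prod‖ ≤ 1 := by
  induction s using Multiset.induction_on with
  | empty => simp
  | cons β s ih =>
    rw [Multiset.prod_cons, norm_mul]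
    exact mul_le_one₀ (hs β (by simp)) (norm_nonneg _) (ih fun γ hγ => hs γ (by simp [hγ]))

theorem norm_eq_one_of_norm_prod_eq_one (s : Multiset ℂ) (hs : ∀ β ∈ s, ‖β‖ ≤ 1)
    (h : ‖s.prod‖ = 1) {β : ℂ} (hβ : β ∈ s) : ‖β‖ = 1 := by
  obtain ⟨t, rfl⟩ := Multiset.exists_cons_of_mem hβ
  rw [Multiset.prod_cons, norm_mul] at h
  have h₁ := hs β hβ
  have h₂ := norm_prod_le_one t fun γ hγ => hs γ (by simp [hγ])
  nlinarith [norm_nonneg β, norm_nonneg t.prod]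

theorem recipNumer_eval_zero {a b m : ℕ} (ha : 0 < a) (hab : a < b) (hb : b < m) :
    ‖(recipNumer ℂ a b m).eval 0‖ = ‖(recipNumer ℂ a b m).roots.prod‖ := by
  rw [recipNumer_eval_eq_prod ha hab hb]
  simp only [zero_sub, Multiset.prod_map_neg, norm_mul, norm_pow, norm_neg, norm_one, one_pow,
    one_mul]

theorem add_one_lt_of_no_roots {a b m : ℕ} (ha : 0 < a) (hab : a < b) (hb : b < m)
    (hW : ∀ z : ℂ, ‖z‖ < 1 → (numer ℂ a b m).eval z ≠ 0) : b + 1 < m := by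
  by_contra! h
  obtain rfl : m = b + 1 := by omega
  have h₁ := norm_prod_le_one _ fun β hβ => norm_root_le_one hab hb hW hβ
  rw [← recipNumer_eval_zero ha hab hb, recipNumer_eval] at h₁
  have : b - a ≠ 0 := by omega
  norm_num [this] at h₁

theorem recipNumer_eq_neg_numer {a b m : ℕ} (ha : 0 < a) (hab : a < b) (hb : b + 1 < m)
    (hW : ∀ z : ℂ, ‖z‖ < 1 → (numer ℂ a b m).eval z ≠ 0) :
    recipNumer ℂ a b m = -numer ℂ a b m := by
  have hb' : b < m := by omega
  have h0 : (recipNumer ℂ a b m).eval 0 = -1 := by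
    have h₁ : m - 1 - a ≠ 0 := by omega
    have h₂ : m - 1 - b ≠ 0 := by omega
    have h₃ : m ≠ 0 := by omega
    rw [recipNumer_eval]
    simp [h₁, h₂, h₃]
  have hn : ∀ β ∈ (recipNumer ℂ a b m).roots, ‖β‖ = 1 := fun β hβ =>
    norm_eq_one_of_norm_prod_eq_one _ (fun γ hγ => norm_root_le_one hab hb' hW hγ)
      (by rw [← recipNumer_eval_zero ha hab hb', h0]; simp) hβ
  refine Polynomial.funext fun z => ?_
  have hconj : (numer ℂ a b m).eval z =
      (starRingEnd ℂ) ((numer ℂ a b m).eval ((starRingEnd ℂ) z)) := by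
    simp [numer_eval]
  have hprod : (recipNumer ℂ a b m).eval z =
      (recipNumer ℂ a b m).eval 0 * (numer ℂ a b m).eval z := by
    rw [hconj, numer_eval_eq_prod ha hab hb', recipNumer_eval_eq_prod ha hab hb',
      recipNumer_eval_eq_prod ha hab hb', map_multiset_prod, Multiset.map_map,
      ← Multiset.prod_map_mul]
    congr 1
    refine Multiset.map_congr rfl fun β hβ => ?_
    have : β * (starRingEnd ℂ) β = 1 := by
      rw [Complex.mul_conj, Complex.normSq_eq_norm_sq, hn β hβ]
      simp
    simp only [Function.comp_apply, map_sub, map_one, map_mul, Complex.conj_conj]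
    linear_combination -z * this
  rw [hprod, h0, eval_neg, neg_one_mul]

theorem eq_of_recipNumer_eq {a b m : ℕ} (hab : a < b) (hb : b + 1 < m)
    (h : recipNumer ℂ a b m = -numer ℂ a b m) : m = a + b + 1 := by
  have h' : (X ^ (m - a) + X ^ (m - b) + X ^ a + X ^ b : ℂ[X]) =
      X ^ (m - 1 - a) + X ^ (m - 1 - b) + X ^ (a + 1) + X ^ (b + 1) := by
    rw [show m - a = m - 1 - a + 1 by omega, show m - b = m - 1 - b + 1 by omega]
    rw [recipNumer, numer] at h
    linear_combination h
  have h₁ := congrArg (fun p => coeff p a) h'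
  have h₂ := congrArg (fun p => coeff p (m - 1 - b)) h'
  simp only [coeff_add, coeff_X_pow] at h₁ h₂
  by_contra hm
  rw [if_pos trivial, if_neg (show ¬ a = m - 1 - b by omega), if_neg (show ¬ a = a + 1 by omega),
    if_neg (show ¬ a = b + 1 by omega), if_neg (show ¬ a = b by omega)] at h₁
  have hma : a = m - 1 - a := by
    by_contra hne
    rw [if_neg hne] at h₁
    split_ifs at h₁ <;> norm_num at h₁
  rw [if_neg (by omega), if_neg (by omega), if_neg (by omega), if_neg (by omega),
    if_neg (by omega), if_pos trivial, if_neg (by omega), if_neg (by omega)] at h₂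
  norm_num at h₂

/-- The Newton identities for the polynomial `∏ (1 - β X)`, in generating function form. -/
theorem newton_prod (s : Multiset ℂ) :
    PowerSeries.X * ((derivative (s.map fun β => 1 - C β * X).prod : ℂ[X]) : PowerSeries ℂ) =
      -(((s.map fun β => 1 - C β * X).prod : ℂ[X]) : PowerSeries ℂ) *
        PowerSeries.mk fun k => if k = 0 then 0 else (s.map (· ^ k)).sum := by
  induction s using Multiset.induction_on with
  | empty =>
    have : (PowerSeries.mk fun k => if k = 0 then (0 : ℂ) else
        ((0 : Multiset ℂ).map (· ^ k)).sum) = 0 := by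
      ext k
      simp
    rw [this]
    simp
  | cons β s ih =>
    have h₁ : (PowerSeries.mk fun k => if k = 0 then (0 : ℂ) else
        (((β ::ₘ s).map (· ^ k)).sum)) = (PowerSeries.mk fun k => if k = 0 then 0 else β ^ k) +
        PowerSeries.mk fun k => if k = 0 then 0 else (s.map (· ^ k)).sum := by
      ext k
      simp only [PowerSeries.coeff_mk, map_add, Multiset.map_cons, Multiset.sum_cons]
      split_ifs <;> simp
    have h₂ : (1 - PowerSeries.C β * PowerSeries.X) *
        (PowerSeries.mk fun k => if k = 0 then 0 else β ^ k) =
        PowerSeries.C β * PowerSeries.X := by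
      ext k
      rw [sub_mul, one_mul, mul_assoc]
      rcases k with _ | _ | k
      · simp
      · simp [PowerSeries.coeff_succ_X_mul]
      · simp [PowerSeries.coeff_succ_X_mul, pow_succ']
    rw [h₁, Multiset.map_cons, Multiset.prod_cons, derivative_mul]
    simp only [Polynomial.coe_add, Polynomial.coe_mul, derivative_sub, derivative_one,
      derivative_C_mul, derivative_X, mul_one, zero_sub, Polynomial.coe_neg,
      Polynomial.coe_sub, Polynomial.coe_one, Polynomial.coe_C, Polynomial.coe_X]
    linear_combination (1 - PowerSeries.C β * PowerSeries.X) * ih +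
      (((s.map fun β => 1 - C β * X).prod : ℂ[X]) : PowerSeries ℂ) * h₂

/-- The `j`-th power sum of `s` for `j > 0`, extended by zero to the other integers. -/
noncomputable def powerSum (s : Multiset ℂ) (j : ℤ) : ℂ :=
  if 0 < j then (s.map (· ^ j.toNat)).sum else 0

theorem powerSum_of_nonpos (s : Multiset ℂ) {j : ℤ} (hj : j ≤ 0) : powerSum s j = 0 :=
  if_neg hj.not_gt

theorem norm_powerSum_le {s : Multiset ℂ} (hs : ∀ β ∈ s, ‖β‖ ≤ 1) (j : ℤ) :
    ‖powerSum s j‖ ≤ s.card := by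
  rw [powerSum]
  split_ifs
  · refine (norm_multiset_sum_le _).trans ?_
    rw [Multiset.map_map]
    refine (Multiset.sum_le_card_nsmul _ 1 fun x hx => ?_).trans (by simp)
    obtain ⟨β, hβ, rfl⟩ := Multiset.mem_map.1 hx
    simpa using pow_le_one₀ (norm_nonneg β) (hs β hβ)
  · simp

theorem powerSum_nat_sub (s : Multiset ℂ) (n c : ℕ) :
    (if c ≤ n then (if n - c = 0 then (0 : ℂ) else (s.map (· ^ (n - c))).sum) else 0) =
      powerSum s (n - c) := by
  rw [powerSum]
  split_ifs <;> first | omega | rfl | (congr 3; ext; congr 1; omega)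

theorem newton_numer {s : Multiset ℂ} {a b m : ℕ}
    (hs : numer ℂ a b m = (s.map fun β => 1 - C β * X).prod) (n : ℕ) :
    powerSum s n + powerSum s (n - a) - powerSum s (n - (a + 1)) + powerSum s (n - b) -
      powerSum s (n - (b + 1)) - powerSum s (n - m) =
    -(n * ((if n = a then 1 else 0) - (if n = a + 1 then 1 else 0) + (if n = b then 1 else 0) -
      (if n = b + 1 then 1 else 0) - (if n = m then 1 else 0) : ℂ)) := by
  have h := newton_prod s
  rw [← hs] at h
  have e₁ (p : PowerSeries ℂ) : -(numer ℂ a b m : PowerSeries ℂ) * p =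
      -(p * PowerSeries.X ^ 0 + p * PowerSeries.X ^ a - p * PowerSeries.X ^ (a + 1) +
        p * PowerSeries.X ^ b - p * PowerSeries.X ^ (b + 1) - p * PowerSeries.X ^ m) := by
    simp only [numer, Polynomial.coe_add, Polynomial.coe_sub, Polynomial.coe_mul,
      Polynomial.coe_one, Polynomial.coe_pow, Polynomial.coe_X]
    ring
  have e₂ : PowerSeries.coeff n (PowerSeries.X * ((derivative (numer ℂ a b m) : ℂ[X]) :
      PowerSeries ℂ)) = n * (numer ℂ a b m).coeff n := by
    rcases n with _ | n
    · simp
    · rw [PowerSeries.coeff_succ_X_mul, Polynomial.coeff_coe, coeff_derivative]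
      push_cast
      ring
  have e₃ : numer ℂ a b m = X ^ 0 + X ^ a - X ^ (a + 1) + X ^ b - X ^ (b + 1) - X ^ m := by
    rw [numer]
    ring
  have h' := congrArg (PowerSeries.coeff n) h
  rw [e₂, e₁, e₃] at h'
  simp only [map_neg, map_add, map_sub, PowerSeries.coeff_mul_X_pow', PowerSeries.coeff_mk,
    powerSum_nat_sub, coeff_add, coeff_sub, coeff_X_pow] at h'
  push_cast at h'
  have e₄ : (n : ℂ) * (if n = 0 then 1 else 0) = 0 := by
    split_ifs with h0 <;> simp [h0]
  rw [sub_zero] at h'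
  linear_combination h' - e₄

theorem powerSum_value {s : Multiset ℂ} {a b m : ℕ} (hab : a + 2 ≤ b) (hba : b + 2 ≤ 2 * a)
    (hm : m = a + b + 1) (hs : numer ℂ a b m = (s.map fun β => 1 - C β * X).prod) :
    powerSum s (2 * a + b + 1) = 2 * (2 * a + b + 1) ∨
      powerSum s (2 * a + b + 1) = 2 * (2 * a + b + 1) + (a + 1) := by
  subst hm
  have hrec : ∀ n : ℤ, 0 ≤ n → powerSum s n + powerSum s (n - a) - powerSum s (n - a - 1) +
      powerSum s (n - b) - powerSum s (n - b - 1) - powerSum s (n - a - b - 1) =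
    -(n * ((if n = a then 1 else 0) - (if n = a + 1 then 1 else 0) + (if n = b then 1 else 0) -
      (if n = b + 1 then 1 else 0) - (if n = a + b + 1 then 1 else 0) : ℂ)) := fun n hn => by
    lift n to ℕ using hn
    have := newton_numer hs n
    push_cast at this
    simp only [← sub_sub] at this
    rw [this]
    norm_cast
  have hneg : ∀ j : ℤ, j ≤ 0 → powerSum s j = 0 := fun j => powerSum_of_nonpos s
  have hlow : ∀ n : ℤ, n < a → powerSum s n = 0 := fun n hn => by
    rcases le_or_gt n 0 with h0 | h0
    · exact hneg n h0
    · have := hrec n h0.le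
      rw [hneg (n - a) (by omega), hneg (n - a - 1) (by omega), hneg (n - b) (by omega),
        hneg (n - b - 1) (by omega), hneg (n - a - b - 1) (by omega), if_neg (by omega),
        if_neg (by omega), if_neg (by omega), if_neg (by omega), if_neg (by omega)] at this
      linear_combination this
  have ha : powerSum s a = -a := by
    have := hrec a (by omega)
    rw [hlow (a - a) (by omega), hlow (a - a - 1) (by omega), hlow (a - b) (by omega),
      hlow (a - b - 1) (by omega), hlow (a - a - b - 1) (by omega), if_pos (by omega),
      if_neg (by omega), if_neg (by omega), if_neg (by omega), if_neg (by omega)] at this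
    push_cast at this
    linear_combination this
  have ha1 : powerSum s (a + 1) = a + 1 := by
    have := hrec (a + 1) (by omega)
    rw [hlow (a + 1 - a) (by omega), hlow (a + 1 - a - 1) (by omega),
      hlow (a + 1 - b) (by omega), hlow (a + 1 - b - 1) (by omega),
      hlow (a + 1 - a - b - 1) (by omega), if_neg (by omega),
      if_pos (by omega), if_neg (by omega), if_neg (by omega), if_neg (by omega)] at this
    push_cast at this
    linear_combination this
  have hmid : ∀ n : ℤ, a + 2 ≤ n → n < b → powerSum s n = 0 := fun n h₁ h₂ => by
    have := hrec n (by omega)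
    rw [hlow (n - a) (by omega), hlow (n - a - 1) (by omega), hlow (n - b) (by omega),
      hlow (n - b - 1) (by omega), hlow (n - a - b - 1) (by omega), if_neg (by omega),
      if_neg (by omega), if_neg (by omega), if_neg (by omega), if_neg (by omega)] at this
    linear_combination this
  have hb : powerSum s b = -b := by
    have := hrec b (by omega)
    rw [hlow (b - a) (by omega), hlow (b - a - 1) (by omega), hlow (b - b) (by omega),
      hlow (b - b - 1) (by omega), hlow (b - a - b - 1) (by omega), if_neg (by omega),
      if_neg (by omega), if_pos (by omega), if_neg (by omega), if_neg (by omega)] at this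
    push_cast at this
    linear_combination this
  have hb1 : powerSum s (b + 1) = b + 1 := by
    have := hrec (b + 1) (by omega)
    rw [hlow (b + 1 - a) (by omega), hlow (b + 1 - a - 1) (by omega),
      hlow (b + 1 - b) (by omega), hlow (b + 1 - b - 1) (by omega),
      hlow (b + 1 - a - b - 1) (by omega), if_neg (by omega),
      if_neg (by omega), if_neg (by omega), if_pos (by omega), if_neg (by omega)] at this
    push_cast at this
    linear_combination this
  have h2a : powerSum s (2 * a) = a := by
    have := hrec (2 * a) (by omega)
    rw [show (2 * a - a : ℤ) = a by ring, ha, hlow (a - 1) (by omega),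
      hlow (2 * a - b) (by omega), hlow (2 * a - b - 1) (by omega), hlow (a - b - 1) (by omega),
      if_neg (by omega), if_neg (by omega), if_neg (by omega), if_neg (by omega),
      if_neg (by omega)] at this
    linear_combination this
  have h2a1 : powerSum s (2 * a + 1) = -(2 * a + 1) := by
    have := hrec (2 * a + 1) (by omega)
    rw [show (2 * a + 1 - a : ℤ) = a + 1 by ring, ha1, show (a + 1 - 1 : ℤ) = a by ring, ha,
      hlow (2 * a + 1 - b) (by omega), hlow (2 * a + 1 - b - 1) (by omega),
      hlow (a + 1 - b - 1) (by omega),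
      if_neg (by omega), if_neg (by omega), if_neg (by omega), if_neg (by omega),
      if_neg (by omega)] at this
    linear_combination this
  have hsum : powerSum s (a + b) = a + b + powerSum s (b - 1) := by
    have := hrec (a + b) (by omega)
    rw [show (a + b - a : ℤ) = b by ring, show (a + b - b : ℤ) = a by ring, hb, ha,
      hlow (a - 1) (by omega), hlow (b - b - 1) (by omega),
      if_neg (by omega), if_neg (by omega), if_neg (by omega), if_neg (by omega),
      if_neg (by omega)] at this
    linear_combination this
  have hsum1 : powerSum s (a + b + 1) = -(a + b + 1) := by
    have := hrec (a + b + 1) (by omega)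
    rw [show (a + b + 1 - a : ℤ) = b + 1 by ring, show (a + b + 1 - b : ℤ) = a + 1 by ring,
      show (b + 1 - 1 : ℤ) = b by ring, show (a + 1 - 1 : ℤ) = a by ring, hb, ha, hb1, ha1,
      hlow (b + 1 - b - 1) (by omega),
      if_neg (by omega), if_neg (by omega), if_neg (by omega), if_neg (by omega),
      if_pos (by omega)] at this
    push_cast at this
    linear_combination this
  have hfin : powerSum s (2 * a + b + 1) = 2 * (2 * a + b + 1) + powerSum s (b - 1) := by
    have := hrec (2 * a + b + 1) (by omega)
    rw [show (2 * a + b + 1 - a : ℤ) = a + b + 1 by ring,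
      show (2 * a + b + 1 - b : ℤ) = 2 * a + 1 by ring, show (a + b + 1 - 1 : ℤ) = a + b by ring,
      show (2 * a + 1 - 1 : ℤ) = 2 * a by ring, show (a + b + 1 - b - 1 : ℤ) = a by ring,
      h2a, h2a1, hsum, hsum1, ha,
      if_neg (by omega), if_neg (by omega), if_neg (by omega), if_neg (by omega),
      if_neg (by omega)] at this
    linear_combination this
  rcases hab.eq_or_lt with rfl | hlt
  · right
    rw [hfin]
    push_cast
    rw [show (a + 2 - 1 : ℤ) = a + 1 by ring, ha1]
  · left
    rw [hfin, hmid (b - 1) (by omega) (by omega), add_zero]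

theorem not_between_of_no_roots {a b m : ℕ} (hab : a + 2 ≤ b) (hba : b + 2 ≤ 2 * a)
    (hm : m = a + b + 1)
    (hW : ∀ z : ℂ, ‖z‖ < 1 → (numer ℂ a b m).eval z ≠ 0) : False := by
  have h := norm_powerSum_le
    (fun β hβ => norm_root_le_one (show a < b by omega) (show b < m by omega) hW hβ)
    (2 * a + b + 1)
  rw [recipNumer_card_roots (by omega) (by omega) (by omega)] at h
  have hv := powerSum_value hab hba hm
    (numer_eq_prod (by omega) (by omega) (show b < m by omega))
  have hcast : (m : ℝ) = a + b + 1 := by exact_mod_cast hm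
  have ha : (0 : ℝ) ≤ a := a.cast_nonneg
  have hb : (0 : ℝ) ≤ b := b.cast_nonneg
  rcases hv with hv | hv <;> rw [hv] at h
  · have : ‖(2 * (2 * a + b + 1) : ℂ)‖ = 2 * (2 * a + b + 1) := by
      rw [show (2 * (2 * a + b + 1) : ℂ) = ((2 * (2 * a + b + 1) : ℕ) : ℂ) by push_cast; ring,
        Complex.norm_natCast]
      push_cast
      ring
    linarith
  · have : ‖(2 * (2 * a + b + 1) + (a + 1) : ℂ)‖ = 2 * (2 * a + b + 1) + (a + 1) := by
      rw [show (2 * (2 * a + b + 1) + (a + 1) : ℂ) =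
        ((2 * (2 * a + b + 1) + (a + 1) : ℕ) : ℂ) by push_cast; ring, Complex.norm_natCast]
      push_cast
      ring
    linarith

theorem summable_mul_pow {g : ℕ → ℤ} (hg : ∀ n, |g n| ≤ 1) {z : ℂ} (hz : ‖z‖ < 1) :
    Summable fun n => ‖(g n : ℂ) * z ^ n‖ := by
  refine (summable_geometric_of_lt_one (norm_nonneg z) hz).of_nonneg_of_le
    (fun n => norm_nonneg _) fun n => ?_
  rw [norm_mul, norm_pow]
  refine mul_le_of_le_one_left (by positivity) ?_
  rw [Complex.norm_intCast]
  exact_mod_cast hg n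

theorem tsum_coeff_mul_polynomial {g : ℕ → ℤ} (hg : ∀ n, |g n| ≤ 1) (P : ℤ[X]) {z : ℂ}
    (hz : ‖z‖ < 1) :
    ∑' n, ((PowerSeries.coeff n (PowerSeries.mk g * (P : PowerSeries ℤ)) : ℤ) : ℂ) * z ^ n =
      (∑' n, (g n : ℂ) * z ^ n) * aeval z P := by
  have hP : ∀ n ∉ Finset.range (P.natDegree + 1), (P.coeff n : ℂ) * z ^ n = 0 := fun n hn => by
    rw [coeff_eq_zero_of_natDegree_lt (by simpa [Nat.lt_succ_iff] using hn)]
    simp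
  have hPs : Summable fun n => ‖(P.coeff n : ℂ) * z ^ n‖ :=
    summable_of_ne_finset_zero (s := Finset.range (P.natDegree + 1)) fun n hn => by
      rw [hP n hn, norm_zero]
  rw [aeval_eq_sum_range, Finset.sum_congr rfl fun n _ => zsmul_eq_mul (z ^ n) (P.coeff n),
    ← tsum_eq_sum (L := SummationFilter.unconditional ℕ) hP,
    tsum_mul_tsum_eq_tsum_sum_antidiagonal_of_summable_norm
      (summable_mul_pow hg hz) hPs]
  refine tsum_congr fun n => ?_
  rw [PowerSeries.coeff_mul, Int.cast_sum, Finset.sum_mul]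
  refine Finset.sum_congr rfl fun p hp => ?_
  rw [← Finset.HasAntidiagonal.mem_antidiagonal.1 hp, PowerSeries.coeff_mk,
    Polynomial.coeff_coe, pow_add]
  push_cast
  ring

theorem tsum_spread (f : ℕ → ℤ) (z : ℂ) :
    ∑' n, ((spread f n : ℤ) : ℂ) * z ^ n = ∑' n, (f n : ℂ) * (z ^ 2) ^ n := by
  have hinj : Function.Injective fun n : ℕ => 2 * n := fun x y h => by
    simpa using h
  rw [← hinj.tsum_eq]
  · refine tsum_congr fun n => ?_
    rw [spread_two_mul, pow_mul]
  · intro n hn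
    rcases Nat.even_or_odd' n with ⟨k, rfl | rfl⟩
    · exact ⟨k, rfl⟩
    · simp [spread_two_mul_add_one] at hn

theorem tsum_ne_zero_of_small {f : ℕ → ℤ} (h0 : f 0 = 1) (hf : ∀ n, |f n| ≤ 1) {z : ℂ}
    (hz : ‖z‖ < 1 / 2) : ∑' n, (f n : ℂ) * z ^ n ≠ 0 := by
  intro h
  have hz1 : ‖z‖ < 1 := by linarith
  have hs := summable_mul_pow hf hz1
  rw [hs.of_norm.tsum_eq_zero_add, h0, pow_zero, Int.cast_one, mul_one] at h
  have hs' : Summable fun n => ‖(f (n + 1) : ℂ) * z ^ (n + 1)‖ := (summable_nat_add_iff 1).2 hs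
  have hg : Summable fun n => ‖z‖ * ‖z‖ ^ n :=
    (summable_geometric_of_lt_one (norm_nonneg z) hz1).mul_left _
  have hle : ‖∑' n, (f (n + 1) : ℂ) * z ^ (n + 1)‖ ≤ ‖z‖ * (1 - ‖z‖)⁻¹ := by
    refine (norm_tsum_le_tsum_norm hs').trans ?_
    rw [← tsum_geometric_of_lt_one (norm_nonneg z) hz1, ← tsum_mul_left]
    refine hs'.tsum_le_tsum (fun n => ?_) hg
    rw [norm_mul, norm_pow, Complex.norm_intCast, ← pow_succ']
    refine mul_le_of_le_one_left (by positivity) ?_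
    exact_mod_cast hf (n + 1)
  rw [← neg_eq_of_add_eq_zero_right h, norm_neg, norm_one, ← div_eq_mul_inv,
    le_div_iff₀ (by linarith)] at hle
  linarith

theorem numer_eval_ne_zero {f : ℕ → ℤ} {a b m : ℕ} (h0 : f 0 = 1) (hf : ∀ n, |f n| ≤ 1)
    (hm : 0 < m)
    (hF : PowerSeries.mk f * (numer ℤ a b m : PowerSeries ℤ) =
      PowerSeries.mk (spread f) * (((1 - X) * (1 - X ^ m) : ℤ[X]) : PowerSeries ℤ))
    (z : ℂ) (hz : ‖z‖ < 1) : (numer ℂ a b m).eval z ≠ 0 := by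
  intro hW
  have hsp : ∀ n, |spread f n| ≤ 1 := fun n => by
    rw [spread]
    split_ifs
    · exact hf _
    · simp
  have hfun : ∀ w : ℂ, ‖w‖ < 1 → (∑' n, (f n : ℂ) * w ^ n) * (numer ℂ a b m).eval w =
      (∑' n, (f n : ℂ) * (w ^ 2) ^ n) * ((1 - w) * (1 - w ^ m)) := fun w hw => by
    have h₁ := tsum_coeff_mul_polynomial hf (numer ℤ a b m) hw
    rw [hF, tsum_coeff_mul_polynomial hsp _ hw, tsum_spread] at h₁
    simp only [numer, map_add, map_sub, map_mul, map_one, map_pow, aeval_X] at h₁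
    rw [numer_eval, h₁]
  have hstep : ∀ w : ℂ, ‖w‖ < 1 → (∑' n, (f n : ℂ) * w ^ n) * (numer ℂ a b m).eval w = 0 →
      ∑' n, (f n : ℂ) * (w ^ 2) ^ n = 0 := fun w hw h => by
    rw [hfun w hw] at h
    have hne : ∀ k, 0 < k → 1 - w ^ k ≠ 0 := fun k hk he => by
      have := pow_lt_one₀ (norm_nonneg w) hw hk.ne'
      rw [← norm_pow, ← sub_eq_zero.1 he, norm_one] at this
      exact this.false
    have h₁ := hne 1 one_pos
    rw [pow_one] at h₁
    exact (mul_eq_zero.1 h).resolve_right (mul_ne_zero h₁ (hne m hm))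
  have hiter : ∀ k, ∑' n, (f n : ℂ) * (z ^ 2 ^ (k + 1)) ^ n = 0 := fun k => by
    induction k with
    | zero => simpa using hstep z hz (by rw [hW, mul_zero])
    | succ k ih =>
      have := hstep (z ^ 2 ^ (k + 1))
        (by rw [norm_pow]; exact pow_lt_one₀ (norm_nonneg z) hz (by positivity))
        (by rw [ih, zero_mul])
      rwa [← pow_mul, ← pow_succ] at this
  obtain ⟨k, hk⟩ := exists_pow_lt_of_lt_one (show (0 : ℝ) < 1 / 2 by norm_num) hz
  refine tsum_ne_zero_of_small h0 hf ?_ (hiter k)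
  rw [norm_pow]
  refine (pow_le_pow_of_le_one (norm_nonneg z) hz.le ?_).trans_lt hk
  exact (Nat.lt_two_pow_self.le).trans (Nat.pow_le_pow_right two_pos k.le_succ)

theorem parameters_of_functional_equation {f : ℕ → ℤ} {a b m : ℕ} (ha : 0 < a) (hab : a < b)
    (hbm : b < m) (he : Even a) (h0 : f 0 = 1) (hf : ∀ n, |f n| ≤ 1) (hfb : f b = 0)
    (hF : PowerSeries.mk f * (numer ℤ a b m : PowerSeries ℤ) =
      PowerSeries.mk (spread f) * (((1 - X) * (1 - X ^ m) : ℤ[X]) : PowerSeries ℤ)) :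
    ∃ l : ℕ, 0 < l ∧ a = 2 ^ (2 * l + 1) - 2 ∧ b = 2 ^ (2 * l + 1) - 1 ∧
      m = 2 ^ (2 * l + 2) - 2 := by
  have hW := numer_eval_ne_zero h0 hf (by omega) hF
  have hb1 := add_one_lt_of_no_roots ha hab hbm hW
  have hm := eq_of_recipNumer_eq hab hb1 (recipNumer_eq_neg_numer ha hab hb1 hW)
  obtain ⟨A, rfl⟩ := even_iff_two_dvd.1 he
  have hlt := lt_of_bounded h0 hf (by omega) hab hbm hfb hF
  obtain rfl : b = 2 * A + 1 := by
    by_contra hne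
    exact not_between_of_no_roots (by omega) (by omega) hm hW
  obtain ⟨l, hl, hA⟩ := exists_eq_of_consecutive h0 hf (by omega) hm hF
  refine ⟨l, hl, ?_, ?_, ?_⟩ <;> simp only [pow_succ, ← hA] <;> omega

section Representation

open Finset hiding antidiagonal mem_antidiagonal
open Finset.HasAntidiagonal

/-- The indicator function of a set of natural numbers. -/
noncomputable def ind (S : Set ℕ) (n : ℕ) : ℤ := S.indicator 1 n

theorem ind_of_mem {S : Set ℕ} {n : ℕ} (h : n ∈ S) : ind S n = 1 := by
  simp [ind, h]

theorem ind_of_notMem {S : Set ℕ} {n : ℕ} (h : n ∉ S) : ind S n = 0 := by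
  simp [ind, h]

/-- Ordered representations of `n` are counted by twice `R S n` and a diagonal term. -/
theorem sum_antidiagonal_ind (S : Set ℕ) (n : ℕ) :
    ∑ p ∈ antidiagonal n, ind S p.1 * ind S p.2 = 2 * R S n + spread (ind S) n := by
  classical
  have hR : (R S n : ℤ) =
      ∑ p ∈ antidiagonal n, if p.1 < p.2 then ind S p.1 * ind S p.2 else 0 := by
    have : {p : ℕ × ℕ | p.1 ∈ S ∧ p.2 ∈ S ∧ p.1 < p.2 ∧ p.1 + p.2 = n} =
        ↑{p ∈ antidiagonal n | p.1 < p.2 ∧ p.1 ∈ S ∧ p.2 ∈ S} := by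
      ext p
      simp only [Set.mem_ofPred_eq, coe_filter, mem_antidiagonal]
      tauto
    rw [R, this, Set.ncard_coe_finset, card_filter, Nat.cast_sum]
    refine sum_congr rfl fun p _ => ?_
    by_cases h₁ : p.1 ∈ S <;> by_cases h₂ : p.2 ∈ S <;>
      simp [h₁, h₂, ind_of_mem, ind_of_notMem]
  have hswap : ∑ p ∈ antidiagonal n, (if p.2 < p.1 then ind S p.1 * ind S p.2 else 0) =
      ∑ p ∈ antidiagonal n, if p.1 < p.2 then ind S p.1 * ind S p.2 else 0 := by
    rw [← Nat.sum_antidiagonal_swap]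
    exact sum_congr rfl fun p _ => by simp [mul_comm]
  have hdiag : ∑ p ∈ antidiagonal n, (if p.1 = p.2 then ind S p.1 * ind S p.2 else 0) =
      spread (ind S) n := by
    have hsq : ∀ k, ind S k * ind S k = ind S k := fun k => by
      by_cases h : k ∈ S <;> simp [h, ind_of_mem, ind_of_notMem]
    rcases Nat.even_or_odd' n with ⟨k, rfl | rfl⟩
    · rw [spread_two_mul, sum_eq_single (k, k)]
      · simp [hsq]
      · rintro ⟨i, j⟩ hp hne
        rw [mem_antidiagonal] at hp
        rw [if_neg]
        intro h
        exact hne (Prod.ext (by omega) (by omega))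
      · intro h
        exact (h (by rw [mem_antidiagonal]; ring)).elim
    · rw [spread_two_mul_add_one]
      refine sum_eq_zero fun p hp => if_neg fun h => ?_
      rw [mem_antidiagonal] at hp
      omega
  rw [hR, two_mul, ← hdiag]
  nth_rw 2 [← hswap]
  rw [← sum_add_distrib, ← sum_add_distrib]
  refine sum_congr rfl fun p _ => ?_
  rcases lt_trichotomy p.1 p.2 with h | h | h
  · simp [h, h.not_gt, h.ne]
  · simp [h]
  · simp [h, h.not_gt, h.ne']

theorem mk_ind_AP_mul (r m : ℕ) (hr : r < m) :
    PowerSeries.mk (ind (AP r m)) * (1 - PowerSeries.X ^ m) =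
      (PowerSeries.X ^ r : PowerSeries ℤ) := by
  ext n
  rw [mul_sub, mul_one, map_sub, PowerSeries.coeff_mul_X_pow', PowerSeries.coeff_mk,
    PowerSeries.coeff_X_pow]
  split_ifs with h₁ h₂ h₂
  · omega
  · rw [PowerSeries.coeff_mk, sub_eq_zero]
    by_cases h : n ∈ AP r m
    · rw [ind_of_mem h, ind_of_mem]
      obtain ⟨_ | k, hk⟩ := h
      · omega
      · exact ⟨k, by rw [hk, mul_add]; omega⟩
    · rw [ind_of_notMem h, ind_of_notMem]
      rintro ⟨k, hk⟩
      exact h ⟨k + 1, by rw [mul_add]; omega⟩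
  · rw [ind_of_mem (S := AP r m) ⟨0, by omega⟩, sub_zero]
  · rw [ind_of_notMem, sub_zero]
    rintro ⟨_ | k, hk⟩
    · omega
    · rw [mul_add] at hk
      omega

theorem functional_equation {a b m : ℕ} (hab : a < b) (hbm : b < m) {S T : Set ℕ}
    (hST : S ∪ T = Set.univ) (hi : S ∩ T = AP a m ∪ AP b m) (hR : ∀ n, R S n = R T n) :
    PowerSeries.mk (fun n => ind S n - ind T n) * (numer ℤ a b m : PowerSeries ℤ) =
      PowerSeries.mk (spread fun n => ind S n - ind T n) *
        (((1 - X) * (1 - X ^ m) : ℤ[X]) : PowerSeries ℤ) := by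
  have hsum : PowerSeries.mk (ind S) + PowerSeries.mk (ind T) =
      PowerSeries.mk (1 : ℕ → ℤ) + PowerSeries.mk (ind (AP a m)) +
        PowerSeries.mk (ind (AP b m)) := by
    ext n
    simp only [map_add, PowerSeries.coeff_mk, Pi.one_apply]
    have h₁ : n ∈ S ∪ T := hST ▸ Set.mem_univ n
    have h₂ : n ∈ S ∩ T ↔ n ∈ AP a m ∪ AP b m := by rw [hi]
    have h₃ : ¬ (n ∈ AP a m ∧ n ∈ AP b m) := by
      rintro ⟨⟨k, hk⟩, ⟨l, hl⟩⟩
      have h := congrArg (· % m) (hk.symm.trans hl)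
      simp only [Nat.add_mul_mod_self_left, Nat.mod_eq_of_lt hbm,
        Nat.mod_eq_of_lt (hab.trans hbm)] at h
      omega
    simp only [Set.mem_union, Set.mem_inter_iff] at h₁ h₂
    by_cases hS : n ∈ S <;> by_cases hT : n ∈ T <;> by_cases hA : n ∈ AP a m <;>
      by_cases hB : n ∈ AP b m <;> simp_all [ind_of_mem, ind_of_notMem]
  have hdiff : PowerSeries.mk (fun n => ind S n - ind T n) =
      PowerSeries.mk (ind S) - PowerSeries.mk (ind T) := by
    ext n
    simp
  have hprod : (PowerSeries.mk (ind S) - PowerSeries.mk (ind T)) *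
      (PowerSeries.mk (ind S) + PowerSeries.mk (ind T)) =
      PowerSeries.mk (spread fun n => ind S n - ind T n) := by
    rw [show (PowerSeries.mk (ind S) - PowerSeries.mk (ind T)) *
      (PowerSeries.mk (ind S) + PowerSeries.mk (ind T)) =
      PowerSeries.mk (ind S) * PowerSeries.mk (ind S) -
        PowerSeries.mk (ind T) * PowerSeries.mk (ind T) by ring]
    ext n
    simp only [map_sub, PowerSeries.coeff_mul, PowerSeries.coeff_mk]
    rw [sum_antidiagonal_ind, sum_antidiagonal_ind, hR n, spread, spread, spread]
    split_ifs <;> ring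
  have hone : PowerSeries.mk (1 : ℕ → ℤ) * (1 - PowerSeries.X) = 1 :=
    PowerSeries.mk_one_mul_one_sub_eq_one ℤ
  have ha := mk_ind_AP_mul a m (hab.trans hbm)
  have hb := mk_ind_AP_mul b m hbm
  rw [← hprod, hsum, hdiff]
  simp only [numer, Polynomial.coe_add, Polynomial.coe_sub, Polynomial.coe_mul,
    Polynomial.coe_one, Polynomial.coe_pow, Polynomial.coe_X]
  rw [← ha, ← hb]
  linear_combination -(PowerSeries.mk (ind S) - PowerSeries.mk (ind T)) *
    (1 - PowerSeries.X ^ m) * hone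

theorem parameters_of_zero_mem {a b m : ℕ} (ha : 0 < a) (hab : a < b) (hbm : b < m)
    (he : Even a) {S T : Set ℕ} (hST : S ∪ T = Set.univ) (hi : S ∩ T = AP a m ∪ AP b m)
    (hR : ∀ n, R S n = R T n) (h0 : 0 ∈ S) :
    ∃ l : ℕ, 0 < l ∧ a = 2 ^ (2 * l + 1) - 2 ∧ b = 2 ^ (2 * l + 1) - 1 ∧
      m = 2 ^ (2 * l + 2) - 2 := by
  have h0T : 0 ∉ T := fun h => by
    have : 0 ∈ AP a m ∪ AP b m := hi ▸ ⟨h0, h⟩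
    rcases this with ⟨k, hk⟩ | ⟨k, hk⟩ <;> omega
  have hb : b ∈ S ∩ T := hi ▸ Or.inr ⟨0, by simp⟩
  refine parameters_of_functional_equation ha hab hbm he (f := fun n => ind S n - ind T n)
    ?_ (fun n => ?_) ?_ (functional_equation hab hbm hST hi hR)
  · simp [ind_of_mem h0, ind_of_notMem h0T]
  · by_cases h₁ : n ∈ S <;> by_cases h₂ : n ∈ T <;> simp [h₁, h₂, ind_of_mem, ind_of_notMem]
  · simp [ind_of_mem hb.1, ind_of_mem hb.2]

end Representation

theorem stmt_2 (r₁ r₂ m : ℕ) (h₁ : 0 < r₁) (h₂ : r₁ < r₂) (h₃ : r₂ < m)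
    (h₄ : Even r₁)
    (h : ∃ C D : Set ℕ, C ∪ D = Set.univ ∧ C ∩ D = AP r₁ m ∪ AP r₂ m ∧
      ∀ n : ℕ, R C n = R D n) :
    ∃ l : ℕ, 0 < l ∧ r₁ = 2 ^ (2 * l + 1) - 2 ∧ r₂ = 2 ^ (2 * l + 1) - 1 ∧
      m = 2 ^ (2 * l + 2) - 2 := by
  obtain ⟨C, D, hCD, hi, hR⟩ := h
  rcases (hCD ▸ Set.mem_univ 0 : 0 ∈ C ∪ D) with h0 | h0
  · exact parameters_of_zero_mem h₁ h₂ h₃ h₄ hCD hi hR h0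
  · exact parameters_of_zero_mem h₁ h₂ h₃ h₄ (Set.union_comm C D ▸ hCD)
      (Set.inter_comm C D ▸ hi) (fun n => (hR n).symm) h0
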